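/- Let f_1,…,f_m ∈ ℝ[x_1,x_2]. There exists a nonzero polynomial q, with real coefficients, in the 4 entries of a 2×2 matrix, such that every V ∈ ℚ^{2×2} with q(V) ≠ 0 is invertible and has the following property. Write f̃_i(x) = f_i(Vx). For every sign condition σ ∈ {<,=,>}^m, every connected component C of {x ∈ ℝ² : f̃_1(x) σ_1 0, …, f̃_m(x) σ_m 0}, and every z ∈ Z(C), there exists an index i_0 with f̃_{i_0} ≠ 0 and f̃_{i_0}(z) = 0 such that at least one of the following holds: (a) some irreducible factor p of f̃_{i_0} in ℂ[x_1,x_2] satisfies p(z) = 0 and (∂p/∂x_2)(z) = 0; (b) two non-associated irreducible factors of f̃_{i_0} in ℂ[x_1,x_2] both vanish at z; (c) there exists i_1 ≠ i_0 with f̃_{i_1}(z) = 0 and z is an isolated point of the set {x ∈ ℂ² : f̃_{i_0}(x) = f̃_{i_1}(x) = 0}. -/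

import Mathlib

open MvPolynomial Set

/-- A sign symbol among `<, =, >`. -/
inductive Sign3 | lt | eq | gt
deriving DecidableEq

/-- The relation "`t σ 0`" for a sign symbol `σ`. -/
def Sign3.holds : Sign3 → ℝ → Prop
  | .lt, t => t < 0
  | .eq, t => t = 0
  | .gt, t => 0 < t

/-- The projection `π_1` of a subset of `ℝ²` to its first coordinate. -/
def proj1 (A : Set (Fin 2 → ℝ)) : Set ℝ := (fun x => x 0) '' A

/-- `Z_inf(A)` with respect to the first coordinate. -/
def Zinf (A : Set (Fin 2 → ℝ)) : Set (Fin 2 → ℝ) :=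
  {x | x ∈ closure A ∧ BddBelow (proj1 A) ∧ x 0 = sInf (proj1 A)}

/-- `Z_sup(A)` with respect to the first coordinate. -/
def Zsup (A : Set (Fin 2 → ℝ)) : Set (Fin 2 → ℝ) :=
  {x | x ∈ closure A ∧ BddAbove (proj1 A) ∧ x 0 = sSup (proj1 A)}

/-- `Z(A) = Z_inf(A) ∪ Z_sup(A)`. -/
def ZZ (A : Set (Fin 2 → ℝ)) : Set (Fin 2 → ℝ) := Zinf A ∪ Zsup A

/-- The polynomial `x ↦ p(Vx)`. -/
noncomputable def compMat (V : Matrix (Fin 2) (Fin 2) ℚ)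
    (p : MvPolynomial (Fin 2) ℝ) : MvPolynomial (Fin 2) ℝ :=
  aeval (fun j : Fin 2 => ∑ k : Fin 2, C ((V j k : ℚ) : ℝ) * X k) p

open Filter Topology

section LocalAnalysis

variable {p f : MvPolynomial (Fin 2) ℂ} {z : Fin 2 → ℂ}

/-- The partial derivative `pderiv i` is the derivative along the `i`-th coordinate. -/
theorem hasDerivAt_eval_update {σ : Type*} [DecidableEq σ] (p : MvPolynomial σ ℂ) (i : σ)
    (z : σ → ℂ) (y : ℂ) :
    HasDerivAt (fun y => eval (Function.update z i y) p)
      (eval (Function.update z i y) (pderiv i p)) y := by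
  induction p using MvPolynomial.induction_on with
  | C a => simpa using hasDerivAt_const y a
  | add p q hp hq => simpa using hp.fun_add hq
  | mul_X p j hp =>
    have hX : HasDerivAt (fun y => eval (Function.update z i y) (X j))
        (eval (Function.update z i y) (pderiv i (X j))) y := by
      by_cases h : j = i
      · subst h
        simpa using hasDerivAt_id' y
      · simpa [h, pderiv_X_of_ne h] using hasDerivAt_const y (z j)
    simpa [Derivation.leibniz, add_comm, mul_comm] using hp.fun_mul hX

/-- Near a zero where the second partial derivative does not vanish, the zero set of a complex
bivariate polynomial is the graph of an analytic function of the first coordinate. -/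
theorem exists_analyticAt_graph (hz : eval z p = 0) (hd : eval z (pderiv 1 p) ≠ 0) :
    ∃ g : ℂ → ℂ, AnalyticAt ℂ g (z 0) ∧ g (z 0) = z 1 ∧
      ∀ᶠ x in 𝓝 z, eval x p = 0 ↔ x 1 = g (x 0) := by
  set F : ℂ × ℂ → ℂ := fun v => eval ![v.1, v.2] p with hF
  have hvec : ∀ x : Fin 2 → ℂ, ![x 0, x 1] = x := fun x => by
    ext i; fin_cases i <;> rfl
  have hFan : AnalyticAt ℂ F (z 0, z 1) := by
    have := AnalyticAt.aeval_mvPolynomial (𝕜 := ℂ) (z := (z 0, z 1))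
      (f := fun v : ℂ × ℂ => ![v.1, v.2]) (fun i => by
        fin_cases i
        · exact analyticAt_fst
        · exact analyticAt_snd) p
    exact this
  have hcd : ContDiffAt ℂ ⊤ F (z 0, z 1) := hFan.contDiffAt
  have hone : (fderiv ℂ F (z 0, z 1) ∘L .inr ℂ ℂ ℂ) 1 = eval z (pderiv 1 p) := by
    have h₁ : HasDerivAt (fun y => F (z 0, y)) (fderiv ℂ F (z 0, z 1) (0, 1)) (z 1) :=
      hFan.differentiableAt.hasFDerivAt.comp_hasDerivAt (z 1)
        ((hasDerivAt_const (z 1) (z 0)).prodMk (hasDerivAt_id (z 1)))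
    have h₂ := hasDerivAt_eval_update p 1 z (z 1)
    have hup : ∀ y, Function.update z 1 y = ![z 0, y] := fun y => by
      ext i; fin_cases i <;> simp
    simp only [hup, hvec] at h₂
    simpa using h₁.unique h₂
  have hinv : (fderiv ℂ F (z 0, z 1) ∘L .inr ℂ ℂ ℂ).IsInvertible := by
    refine ⟨ContinuousLinearEquiv.unitsEquivAut ℂ (Units.mk0 _ hd), ?_⟩
    ext
    rw [hone]
    simp
  refine ⟨hcd.implicitFunction (by simp) hinv,
    (hcd.contDiffAt_implicitFunction (by simp) hinv).analyticAt,
    hcd.implicitFunction_apply_self (by simp) hinv, ?_⟩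
  have hev := hcd.eventually_apply_eq_iff_implicitFunction (by simp) hinv
  have ht : Tendsto (fun x : Fin 2 → ℂ => (x 0, x 1)) (𝓝 z) (𝓝 (z 0, z 1)) :=
    Continuous.tendsto (by fun_prop) z
  filter_upwards [ht.eventually hev] with x hx
  simp only [hF, hvec, hz] at hx
  rw [hx, eq_comm]

/-- A nonzero polynomial vanishing at a point has an irreducible factor vanishing there. -/
theorem exists_irreducible_dvd_eval_eq_zero {σ : Type*} {f : MvPolynomial σ ℂ} {z : σ → ℂ}
    (hf : f ≠ 0) (hz : eval z f = 0) : ∃ p, Irreducible p ∧ p ∣ f ∧ eval z p = 0 := by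
  induction f using WfDvdMonoid.induction_on_irreducible with
  | zero => exact absurd rfl hf
  | unit u hu => exact absurd hz (hu.map (eval z)).ne_zero
  | mul a i ha hi ih =>
    rcases mul_eq_zero.mp ((map_mul (eval z) i a).symm.trans hz) with h | h
    · exact ⟨i, hi, dvd_mul_right _ _, h⟩
    · obtain ⟨p, hp, hpa, hpz⟩ := ih ha h
      exact ⟨p, hp, hpa.mul_left _, hpz⟩

/-- If a single irreducible factor of `f` (up to association) vanishes at `z`, and its second
partial derivative does not, then the zero set of `f` near `z` is an analytic graph. -/
theorem exists_analyticAt_graph_of_factors (hf : f ≠ 0) (hz : eval z f = 0)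
    (ha : ∀ p, Irreducible p → p ∣ f → eval z p = 0 → eval z (pderiv 1 p) ≠ 0)
    (hb : ∀ p p', Irreducible p → Irreducible p' → p ∣ f → p' ∣ f → eval z p = 0 →
      eval z p' = 0 → p ∣ p') :
    ∃ g : ℂ → ℂ, AnalyticAt ℂ g (z 0) ∧ g (z 0) = z 1 ∧
      ∀ᶠ x in 𝓝 z, eval x f = 0 ↔ x 1 = g (x 0) := by
  obtain ⟨p, hp, hpf, hpz⟩ := exists_irreducible_dvd_eval_eq_zero hf hz
  obtain ⟨g, hg, hgz, hgp⟩ := exists_analyticAt_graph hpz (ha p hp hpf hpz)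
  obtain ⟨u, hu, hpu⟩ :=
    (FiniteMultiplicity.of_not_isUnit hp.not_isUnit hf).exists_eq_pow_mul_and_not_dvd
  set k := multiplicity p f
  have hk : k ≠ 0 := by
    intro hk
    rw [hk, pow_zero, one_mul] at hu
    exact hpu (hu ▸ hpf)
  have huf : u ∣ f := ⟨p ^ k, by rw [hu]; ring⟩
  have huz : eval z u ≠ 0 := by
    intro huz
    obtain ⟨p', hp', hpu', hpz'⟩ :=
      exists_irreducible_dvd_eval_eq_zero (ne_zero_of_dvd_ne_zero hf huf) huz
    exact hpu ((hb p p' hp hp' hpf (hpu'.trans huf) hpz hpz').trans hpu')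
  refine ⟨g, hg, hgz, ?_⟩
  filter_upwards [hgp, (MvPolynomial.continuous_eval u).continuousAt.eventually_ne huz]
    with x hx hux
  rw [← hx, hu]
  simp [hux, hk]

/-- If the zero set of `f` near `z` is an analytic graph, then another polynomial either vanishes
on this graph near `z`, or has `z` as an isolated common zero with `f`. -/
theorem eventually_eval_graph_eq_zero_or_isolated {g : ℂ → ℂ} (hg : AnalyticAt ℂ g (z 0))
    (hgz : g (z 0) = z 1) (hf : ∀ᶠ x in 𝓝 z, eval x f = 0 ↔ x 1 = g (x 0))
    (h : MvPolynomial (Fin 2) ℂ) :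
    (∀ᶠ t in 𝓝 (z 0), eval ![t, g t] h = 0) ∨
      ∀ᶠ x in 𝓝 z, eval x f = 0 → eval x h = 0 → x = z := by
  have han : AnalyticAt ℂ (fun t => eval ![t, g t] h) (z 0) := by
    have := AnalyticAt.aeval_mvPolynomial (𝕜 := ℂ) (z := z 0)
      (f := fun t : ℂ => ![t, g t]) (fun i => by
        fin_cases i
        · exact analyticAt_id
        · exact hg) h
    exact this
  refine han.eventually_eq_zero_or_eventually_ne_zero.imp id fun hne => ?_
  rw [eventually_nhdsWithin_iff] at hne
  filter_upwards [hf, (continuous_apply 0).tendsto z |>.eventually hne] with x hx hxne h₁ h₂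
  have hx1 := hx.mp h₁
  have hx0 : x 0 = z 0 := by
    by_contra hx0
    refine hxne hx0 ?_
    rw [← h₂, ← hx1]
    congr 2
    ext i; fin_cases i <;> rfl
  ext i
  fin_cases i
  · exact hx0
  · change x 1 = z 1
    rw [hx1, hx0, hgz]

end LocalAnalysis

section RealGraph

theorem eval_map_ofReal (F : MvPolynomial (Fin 2) ℝ) (x : Fin 2 → ℝ) :
    eval (fun k => (x k : ℂ)) (F.map (algebraMap ℝ ℂ)) = (eval x F : ℝ) := by
  simpa [Function.comp_def] using (eval₂_comp_left (algebraMap ℝ ℂ) (RingHom.id ℝ) x F).symm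

theorem eval_conj_map_ofReal (F : MvPolynomial (Fin 2) ℝ) (x : Fin 2 → ℂ) :
    eval (fun k => (starRingEnd ℂ) (x k)) (F.map (algebraMap ℝ ℂ)) =
      (starRingEnd ℂ) (eval x (F.map (algebraMap ℝ ℂ))) := by
  rw [eval_map, eval_map, eval₂_comp_left]
  congr 1
  ext
  simp

/-- If the complex zero set of a real polynomial is, near a real point, the graph of a function
`g` continuous there, then `g` takes real values at real points nearby. -/
theorem eventually_graph_real {F : MvPolynomial (Fin 2) ℝ} {z : Fin 2 → ℝ} {g : ℂ → ℂ}
    (hg : ContinuousAt g (z 0 : ℂ)) (hgz : g (z 0 : ℂ) = z 1)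
    (hF : ∀ᶠ x in 𝓝 (fun k => (z k : ℂ)),
      eval x (F.map (algebraMap ℝ ℂ)) = 0 ↔ x 1 = g (x 0)) :
    ∀ᶠ t : ℝ in 𝓝 (z 0), g t = ((g t).re : ℂ) := by
  have hgt : Tendsto (fun t : ℝ => g t) (𝓝 (z 0)) (𝓝 (z 1 : ℂ)) := by
    rw [← hgz]
    exact hg.tendsto.comp (Complex.continuous_ofReal.tendsto (z 0))
  have h₁ : Tendsto (fun t : ℝ => ![(t : ℂ), g t]) (𝓝 (z 0)) (𝓝 (fun k => (z k : ℂ))) := by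
    rw [tendsto_pi_nhds]
    intro i
    fin_cases i
    · exact Complex.continuous_ofReal.tendsto (z 0)
    · exact hgt
  have h₂ : Tendsto (fun t : ℝ => fun k => (starRingEnd ℂ) (![(t : ℂ), g t] k)) (𝓝 (z 0))
      (𝓝 (fun k => (z k : ℂ))) := by
    rw [tendsto_pi_nhds] at h₁ ⊢
    intro i
    simpa [Function.comp_def] using (Complex.continuous_conj.tendsto _).comp (h₁ i)
  filter_upwards [h₁.eventually hF, h₂.eventually hF] with t ht₁ ht₂
  have h0 := ht₁.mpr rfl
  have hc := ht₂.mp (by rw [eval_conj_map_ofReal, h0, map_zero])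
  simp only [Matrix.cons_val_zero, Matrix.cons_val_one, Complex.conj_ofReal] at hc
  exact (Complex.conj_eq_iff_re.mp hc).symm

/-- Suppose the zero set of each nonzero `F i` vanishing at `z` is an analytic graph near `z`, and
that `z` is not an isolated common complex zero of two such polynomials. Then near `z` all these
polynomials have the same real zero set, which is the graph of a continuous function. -/
theorem exists_common_real_graph {ι : Type*} (F : ι → MvPolynomial (Fin 2) ℝ) (z : Fin 2 → ℝ)
    (hgraph : ∀ i, F i ≠ 0 → eval z (F i) = 0 → ∃ g : ℂ → ℂ, AnalyticAt ℂ g (z 0 : ℂ) ∧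
      g (z 0 : ℂ) = z 1 ∧ ∀ᶠ x in 𝓝 (fun k => (z k : ℂ)),
        eval x ((F i).map (algebraMap ℝ ℂ)) = 0 ↔ x 1 = g (x 0))
    (hiso : ∀ i j, j ≠ i → F i ≠ 0 → eval z (F i) = 0 → eval z (F j) = 0 →
      ¬ ∀ᶠ x in 𝓝 (fun k => (z k : ℂ)), eval x ((F i).map (algebraMap ℝ ℂ)) = 0 →
        eval x ((F j).map (algebraMap ℝ ℂ)) = 0 → x = fun k => (z k : ℂ)) :
    ∃ h : ℝ → ℝ, h (z 0) = z 1 ∧ (∀ᶠ t in 𝓝 (z 0), ContinuousAt h t) ∧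
      ∀ i, F i ≠ 0 → eval z (F i) = 0 → ∀ᶠ x in 𝓝 z, eval x (F i) = 0 ↔ x 1 = h (x 0) := by
  by_cases hex : ∃ i, F i ≠ 0 ∧ eval z (F i) = 0
  swap
  · exact ⟨fun _ => z 1, rfl, .of_forall fun t => continuousAt_const,
      fun i h₁ h₂ => absurd ⟨i, h₁, h₂⟩ hex⟩
  obtain ⟨i₀, hi₀, hzi₀⟩ := hex
  obtain ⟨g, hg, hgz, hgF⟩ := hgraph i₀ hi₀ hzi₀
  have hcoe : Tendsto (fun t : ℝ => (t : ℂ)) (𝓝 (z 0)) (𝓝 (z 0 : ℂ)) :=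
    Complex.continuous_ofReal.tendsto _
  have hcommon : ∀ i, F i ≠ 0 → eval z (F i) = 0 → ∀ᶠ x in 𝓝 (fun k => (z k : ℂ)),
      eval x ((F i).map (algebraMap ℝ ℂ)) = 0 ↔ x 1 = g (x 0) := by
    intro i hi hzi
    by_cases hii : i = i₀
    · rwa [hii]
    obtain ⟨g', hg', hgz', hgF'⟩ := hgraph i hi hzi
    have hvan := (eventually_eval_graph_eq_zero_or_isolated (z := fun k => (z k : ℂ)) hg hgz hgF
      ((F i).map (algebraMap ℝ ℂ))).resolve_right (hiso i₀ i hii hi₀ hzi₀ hzi)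
    have ht : Tendsto (fun t : ℂ => ![t, g t]) (𝓝 (z 0 : ℂ)) (𝓝 (fun k => (z k : ℂ))) := by
      rw [tendsto_pi_nhds]
      intro k
      fin_cases k
      · exact tendsto_id
      · simpa [← hgz] using hg.continuousAt.tendsto
    have heq : ∀ᶠ t in 𝓝 (z 0 : ℂ), g t = g' t := by
      filter_upwards [hvan, ht.eventually hgF'] with t h₁ h₂
      exact h₂.mp h₁
    filter_upwards [hgF', ((continuous_apply 0).tendsto (fun k => (z k : ℂ))).eventually heq]
      with x h₁ h₂
    rw [h₁, h₂]
  refine ⟨fun t => (g t).re, by simp [hgz], ?_, fun i hi hzi => ?_⟩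
  · filter_upwards [hcoe.eventually hg.eventually_continuousAt] with t ht
    exact Complex.continuous_re.continuousAt.comp
      (ht.comp (f := fun s : ℝ => (s : ℂ)) Complex.continuous_ofReal.continuousAt)
  · have hreal := eventually_graph_real hg.continuousAt hgz hgF
    have hcoe₂ : Tendsto (fun x : Fin 2 → ℝ => fun k => (x k : ℂ)) (𝓝 z)
        (𝓝 (fun k => (z k : ℂ))) := Continuous.tendsto (by fun_prop) z
    filter_upwards [hcoe₂.eventually (hcommon i hi hzi),
      ((continuous_apply 0).tendsto z).eventually hreal] with x h₁ h₂
    rw [eval_map_ofReal, h₂] at h₁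
    exact_mod_cast h₁

end RealGraph

section Cells

theorem isPreconnected_cell {h : ℝ → ℝ} {T S : Set ℝ} (hh : ContinuousOn h T)
    (hT : IsPreconnected T) (hS : IsPreconnected S) (b : ℝ) :
    IsPreconnected ((fun v : ℝ × ℝ => ![v.1, h v.1 + v.2 * (b - h v.1)]) '' (T ×ˢ S)) := by
  refine (hT.prod hS).image _ ?_
  have hc : ContinuousOn (fun v : ℝ × ℝ => h v.1) (T ×ˢ S) :=
    hh.comp continuousOn_fst fun v hv => hv.1
  refine continuousOn_pi.mpr fun i => ?_
  fin_cases i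
  · exact continuousOn_fst
  · exact hc.add (continuousOn_snd.mul (continuousOn_const.sub hc))

/-- Suppose that near `z` a set `R` contains every connected set which it meets and which lies in
the graph of `h`, or avoids this graph. Then a connected component of `R` adherent to `z` projects
onto a neighbourhood of `z 0`. -/
theorem proj1_connectedComponentIn_mem_nhds {R W : Set (Fin 2 → ℝ)} {x₀ z : Fin 2 → ℝ}
    {h : ℝ → ℝ} (hz : z ∈ closure (connectedComponentIn R x₀)) (hhz : h (z 0) = z 1)
    (hcont : ∀ᶠ t in 𝓝 (z 0), ContinuousAt h t) (hW : W ∈ 𝓝 z)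
    (hR : ∀ K ⊆ W, IsPreconnected K →
      ((∀ x ∈ K, x 1 = h (x 0)) ∨ ∀ x ∈ K, x 1 ≠ h (x 0)) → (K ∩ R).Nonempty → K ⊆ R) :
    proj1 (connectedComponentIn R x₀) ∈ 𝓝 (z 0) := by
  obtain ⟨r, hr, hrW⟩ := Metric.mem_nhds_iff.mp hW
  have hnear : ∀ᶠ t in 𝓝 (z 0), |h t - z 1| < r := by
    have := hcont.self_of_nhds.tendsto.eventually (Metric.ball_mem_nhds _ hr)
    simpa [hhz, Real.dist_eq] using this
  obtain ⟨δ, hδ, hball⟩ := Metric.eventually_nhds_iff_ball.mp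
    ((hcont.and hnear).and (Metric.ball_mem_nhds (z 0) hr))
  set T := Metric.ball (z 0) δ with hT
  have hTpre : IsPreconnected T := (convex_ball (z 0) δ).isPreconnected
  have hTcont : ContinuousOn h T := fun t ht => (hball t ht).1.1.continuousWithinAt
  obtain ⟨x, hxC, hxz⟩ := Metric.mem_closure_iff.mp hz (min δ r) (lt_min hδ hr)
  rw [dist_comm] at hxz
  have hx0 : x 0 ∈ T := ((dist_le_pi_dist x z 0).trans_lt hxz).trans_le (min_le_left _ _)
  have hx1 : |x 1 - z 1| < r := by
    rw [← Real.dist_eq]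
    exact ((dist_le_pi_dist x z 1).trans_lt hxz).trans_le (min_le_right _ _)
  have hxR : x ∈ R := connectedComponentIn_subset R x₀ hxC
  have key : ∀ (b : ℝ) (S : Set ℝ), |b - z 1| = r → S ⊆ Ico 0 1 → IsPreconnected S →
      (S = {0} ∨ (0 ∉ S ∧ ∀ t ∈ T, b ≠ h t)) → (∃ s ∈ S, x 1 = h (x 0) + s * (b - h (x 0))) →
      T ⊆ proj1 (connectedComponentIn R x₀) := by
    rintro b S hb hS hSpre hcase ⟨s, hs, hxs⟩
    set K := (fun v : ℝ × ℝ => ![v.1, h v.1 + v.2 * (b - h v.1)]) '' (T ×ˢ S) with hK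
    have hKpre : IsPreconnected K := isPreconnected_cell hTcont hTpre hSpre b
    have hxK : x ∈ K := ⟨(x 0, s), ⟨hx0, hs⟩, by
      ext i
      fin_cases i
      · rfl
      · exact hxs.symm⟩
    have hKW : K ⊆ W := by
      rintro _ ⟨⟨t, u⟩, ⟨ht, hu⟩, rfl⟩
      refine hrW ?_
      rw [Metric.mem_ball, dist_pi_lt_iff hr]
      intro i
      fin_cases i
      · exact (hball t ht).2
      · have h₁ := (hball t ht).1.2
        have hu0 : 0 ≤ u := (hS hu).1
        have hu1 : 0 < 1 - u := sub_pos.mpr (hS hu).2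
        change dist (h t + u * (b - h t)) (z 1) < r
        rw [Real.dist_eq]
        calc |h t + u * (b - h t) - z 1| = |(1 - u) * (h t - z 1) + u * (b - z 1)| := by
              congr 1; ring
          _ ≤ |(1 - u) * (h t - z 1)| + |u * (b - z 1)| := abs_add_le _ _
          _ = (1 - u) * |h t - z 1| + u * r := by
              rw [abs_mul, abs_mul, abs_of_pos hu1, abs_of_nonneg hu0, hb]
          _ < (1 - u) * r + u * r := by gcongr
          _ = r := by ring
    have hKR : K ⊆ R := by
      refine hR K hKW hKpre ?_ ⟨x, hxK, hxR⟩
      rcases hcase with rfl | ⟨h0, hbne⟩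
      · left
        rintro _ ⟨⟨t, u⟩, ⟨-, rfl⟩, rfl⟩
        simp
      · right
        rintro _ ⟨⟨t, u⟩, ⟨ht, hu⟩, rfl⟩
        have hu0 : u ≠ 0 := fun hu' => h0 (hu' ▸ hu)
        simpa [sub_eq_zero, hu0] using hbne t ht
    have hKC : K ⊆ connectedComponentIn R x₀ := by
      rw [connectedComponentIn_eq hxC]
      exact hKpre.subset_connectedComponentIn hxK hKR
    exact fun t ht => ⟨_, hKC ⟨(t, s), ⟨ht, hs⟩, rfl⟩, rfl⟩
  refine mem_of_superset (Metric.ball_mem_nhds (z 0) hδ) ?_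
  have hhx := abs_lt.mp (hball (x 0) hx0).1.2
  rw [abs_lt] at hx1
  have hS : Ioo (0 : ℝ) 1 ⊆ Ico 0 1 := Ioo_subset_Ico_self
  rcases lt_trichotomy (x 1) (h (x 0)) with hlt | heq | hgt
  · refine key (z 1 - r) (Ioo 0 1) (by simp [abs_of_pos hr]) hS isPreconnected_Ioo
      (Or.inr ⟨by simp, fun t ht heq => ?_⟩)
      ⟨(h (x 0) - x 1) / (h (x 0) - (z 1 - r)), ⟨?_, ?_⟩, ?_⟩
    · linarith [(abs_lt.mp (hball t ht).1.2).1]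
    · exact div_pos (by linarith) (by linarith)
    · rw [div_lt_one (by linarith)]; linarith
    · have : h (x 0) - (z 1 - r) ≠ 0 := by linarith
      field_simp
      ring
  · exact key (z 1 + r) {0} (by simp [abs_of_pos hr]) (by simp) isPreconnected_singleton
      (Or.inl rfl) ⟨0, rfl, by simpa using heq⟩
  · refine key (z 1 + r) (Ioo 0 1) (by simp [abs_of_pos hr]) hS isPreconnected_Ioo
      (Or.inr ⟨by simp, fun t ht heq => ?_⟩)
      ⟨(x 1 - h (x 0)) / (z 1 + r - h (x 0)), ⟨?_, ?_⟩, ?_⟩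
    · linarith [(abs_lt.mp (hball t ht).1.2).2]
    · exact div_pos (by linarith) (by linarith)
    · rw [div_lt_one (by linarith)]; linarith
    · have : z 1 + r - h (x 0) ≠ 0 := by linarith
      field_simp
      ring

theorem Sign3.holds_of_isPreconnected {α : Type*} [TopologicalSpace α] {F : α → ℝ}
    (hF : Continuous F) {K : Set α} (hK : IsPreconnected K)
    (hcase : (∀ x ∈ K, F x = 0) ∨ ∀ x ∈ K, F x ≠ 0) {σ : Sign3} {x y : α} (hx : x ∈ K)
    (hy : y ∈ K) (hσ : σ.holds (F x)) : σ.holds (F y) := by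
  rcases hcase with h0 | hne
  · rwa [h0 y hy, ← h0 x hx]
  · have hno : ¬ ∃ w ∈ K, F w = 0 := fun ⟨w, hw, hw0⟩ => hne w hw hw0
    cases σ with
    | lt =>
      by_contra hc
      exact hno (hK.intermediate_value hx hy hF.continuousOn ⟨le_of_lt hσ, not_lt.mp hc⟩)
    | eq => exact absurd hσ (hne x hx)
    | gt =>
      by_contra hc
      exact hno (hK.intermediate_value hy hx hF.continuousOn ⟨not_lt.mp hc, le_of_lt hσ⟩)

/-- If near `z` every nonzero `F i` vanishing at `z` has the graph of `h` as zero set, then `z` is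
not an extremal point of a connected component of a sign condition on the `F i`. -/
theorem notMem_ZZ_of_graph {ι : Type*} [Finite ι] (F : ι → MvPolynomial (Fin 2) ℝ)
    (σ : ι → Sign3) {x₀ z : Fin 2 → ℝ} {h : ℝ → ℝ} (hhz : h (z 0) = z 1)
    (hcont : ∀ᶠ t in 𝓝 (z 0), ContinuousAt h t)
    (hF : ∀ i, F i ≠ 0 → eval z (F i) = 0 → ∀ᶠ x in 𝓝 z, eval x (F i) = 0 ↔ x 1 = h (x 0)) :
    z ∉ ZZ (connectedComponentIn {x | ∀ i, (σ i).holds (eval x (F i))} x₀) := by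
  set R := {x | ∀ i, (σ i).holds (eval x (F i))}
  have hW : ∀ᶠ x in 𝓝 z, ∀ i, F i = 0 ∨ (eval z (F i) ≠ 0 ∧ eval x (F i) ≠ 0) ∨
      (eval z (F i) = 0 ∧ (eval x (F i) = 0 ↔ x 1 = h (x 0))) := by
    refine eventually_all.mpr fun i => ?_
    by_cases h0 : F i = 0
    · exact .of_forall fun x => Or.inl h0
    by_cases hzi : eval z (F i) = 0
    · exact (hF i h0 hzi).mono fun x hx => Or.inr (Or.inr ⟨hzi, hx⟩)
    · exact ((MvPolynomial.continuous_eval (F i)).continuousAt.eventually_ne hzi).mono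
        fun x hx => Or.inr (Or.inl ⟨hzi, hx⟩)
  have hR : ∀ K ⊆ {x | ∀ i, F i = 0 ∨ (eval z (F i) ≠ 0 ∧ eval x (F i) ≠ 0) ∨
      (eval z (F i) = 0 ∧ (eval x (F i) = 0 ↔ x 1 = h (x 0)))}, IsPreconnected K →
      ((∀ x ∈ K, x 1 = h (x 0)) ∨ ∀ x ∈ K, x 1 ≠ h (x 0)) → (K ∩ R).Nonempty → K ⊆ R := by
    rintro K hKW hK hcase ⟨x, hxK, hxR⟩ y hyK i
    refine Sign3.holds_of_isPreconnected (MvPolynomial.continuous_eval (F i)) hK ?_ hxK hyK (hxR i)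
    by_cases h0 : F i = 0
    · simp [h0]
    by_cases hzi : eval z (F i) = 0
    · have hiff : ∀ w ∈ K, eval w (F i) = 0 ↔ w 1 = h (w 0) := fun w hw => by
        simpa [h0, hzi] using hKW hw i
      exact hcase.imp (fun H w hw => (hiff w hw).mpr (H w hw))
        (fun H w hw => (hiff w hw).not.mpr (H w hw))
    · exact Or.inr fun w hw => by simpa [h0, hzi] using hKW hw i
  rintro (⟨hz, hbdd, hext⟩ | ⟨hz, hbdd, hext⟩)
  all_goals
    have hnhds := proj1_connectedComponentIn_mem_nhds hz hhz hcont hW hR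
  · obtain ⟨t, ht, htC⟩ := ((frequently_lt_nhds (z 0)).and_eventually hnhds).exists
    exact absurd (csInf_le hbdd htC) (not_le.mpr (hext ▸ ht))
  · obtain ⟨t, ht, htC⟩ := ((frequently_gt_nhds (z 0)).and_eventually hnhds).exists
    exact absurd (le_csSup hbdd htC) (not_le.mpr (hext ▸ ht))

end Cells

theorem statement12 (m : ℕ) (f : Fin m → MvPolynomial (Fin 2) ℝ) :
    ∃ q : MvPolynomial (Fin 2 × Fin 2) ℝ, q ≠ 0 ∧
      ∀ V : Matrix (Fin 2) (Fin 2) ℚ,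
        eval (fun ij => ((V ij.1 ij.2 : ℚ) : ℝ)) q ≠ 0 →
          IsUnit V ∧
          ∀ σ : Fin m → Sign3,
            ∀ R : Set (Fin 2 → ℝ),
              R = {x | ∀ i, (σ i).holds (eval x (compMat V (f i)))} →
              ∀ x₀ ∈ R, ∀ z ∈ ZZ (connectedComponentIn R x₀),
                ∃ i₀ : Fin m, compMat V (f i₀) ≠ 0 ∧ eval z (compMat V (f i₀)) = 0 ∧
                  ((∃ p : MvPolynomial (Fin 2) ℂ, Irreducible p ∧
                      p ∣ (compMat V (f i₀)).map (algebraMap ℝ ℂ) ∧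
                      eval (fun k => ((z k : ℝ) : ℂ)) p = 0 ∧
                      eval (fun k => ((z k : ℝ) : ℂ)) (pderiv (1 : Fin 2) p) = 0) ∨
                   (∃ p p' : MvPolynomial (Fin 2) ℂ, Irreducible p ∧ Irreducible p' ∧
                      p ∣ (compMat V (f i₀)).map (algebraMap ℝ ℂ) ∧
                      p' ∣ (compMat V (f i₀)).map (algebraMap ℝ ℂ) ∧
                      ¬ (p ∣ p' ∧ p' ∣ p) ∧
                      eval (fun k => ((z k : ℝ) : ℂ)) p = 0 ∧
                      eval (fun k => ((z k : ℝ) : ℂ)) p' = 0) ∨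
                   (∃ i₁ : Fin m, i₁ ≠ i₀ ∧ eval z (compMat V (f i₁)) = 0 ∧
                      ∃ U : Set (Fin 2 → ℂ), IsOpen U ∧ (fun k => ((z k : ℝ) : ℂ)) ∈ U ∧
                        U ∩ {x : Fin 2 → ℂ |
                            eval x ((compMat V (f i₀)).map (algebraMap ℝ ℂ)) = 0 ∧
                            eval x ((compMat V (f i₁)).map (algebraMap ℝ ℂ)) = 0} =
                          {fun k => ((z k : ℝ) : ℂ)})) := by
  refine ⟨X (0, 0) * X (1, 1) - X (0, 1) * X (1, 0), fun h0 => ?_, fun V hV => ⟨?_, ?_⟩⟩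
  · have := congrArg (eval fun ij : Fin 2 × Fin 2 => if ij.1 = ij.2 then (1 : ℝ) else 0) h0
    simp at this
  · rw [Matrix.isUnit_iff_isUnit_det, isUnit_iff_ne_zero, Matrix.det_fin_two]
    simp only [map_sub, map_mul, eval_X] at hV
    exact_mod_cast hV
  rintro σ R rfl x₀ - z hz
  by_contra! hcon
  refine (exists_common_real_graph (fun i => compMat V (f i)) z
    (fun i hi hzi => ?_) (fun i j hij hi hzi hzj hev => ?_)).elim fun h ⟨hhz, hcont, hF⟩ =>
      notMem_ZZ_of_graph _ σ hhz hcont hF hz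
  · obtain ⟨ha, hb, -⟩ := hcon i hi hzi
    refine exists_analyticAt_graph_of_factors (z := fun k => (z k : ℂ))
      ((map_ne_zero_iff _ (map_injective _ (algebraMap ℝ ℂ).injective)).mpr hi)
      (by rw [eval_map_ofReal, hzi, Complex.ofReal_zero]) ha fun p p' hp hp' hpf hpf' hpz hpz' => ?_
    by_contra hdvd
    exact hb p p' hp hp' hpf hpf' (fun h => absurd h hdvd) hpz hpz'
  · obtain ⟨U, hU, hUo, hzU⟩ := eventually_nhds_iff.mp hev
    refine (hcon i hi hzi).2.2 j hij hzj U hUo hzU (Subset.antisymm ?_ ?_)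
    · rintro x ⟨hxU, hx₁, hx₂⟩
      exact hU x hxU hx₁ hx₂
    · rintro _ rfl
      exact ⟨hzU, by rw [eval_map_ofReal, hzi, Complex.ofReal_zero],
        by rw [eval_map_ofReal, hzj, Complex.ofReal_zero]⟩
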